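/- For μ = (μ_1, μ_2, μ_3), the super Yangian satisfies the Serre-type relation [[E_{1;i,j}(u), E_{2;h,k}(v)], E_{2;f,g}(v)] = 0 in Y_{(μ_1,μ_2,μ_3)}[[u^{-1}, v^{-1}]], for all 1 ≤ i ≤ μ_1, 1 ≤ j,h,f ≤ μ_2, 1 ≤ k,g ≤ μ_3. -/

import Mathlib

noncomputable section

namespace SuperYangian

/-- The sign `(-1)^x` for `x : ZMod 2`. -/
def sgn (x : ZMod 2) : ℂ := if x = 0 then 1 else -1

variable {A : Type*}

/-- The supercommutator `[x, y] = x*y - ε • (y*x)` with prescribed sign `ε`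
(for homogeneous `x`, `y` one takes `ε = (-1)^{|x||y|}`). -/
def scomm [Ring A] [Algebra ℂ A] (ε : ℂ) (x y : A) : A := x * y - ε • (y * x)

/-- `off μ a = μ 0 + ⋯ + μ (a-1)`. -/
def off (μ : ℕ → ℕ) (a : ℕ) : ℕ := ∑ b ∈ Finset.range a, μ b

/-- A family `t i j r` (the coefficient of `u^{-r}` in `t_{ij}(u)`, with 0-based
indices `i j < d`) satisfying the defining RTT relations of the super Yangian
`Y(gl_{M|N})` with parity sequence `p`; the super Yangian itself, via
`t_{i+1,j+1}^{(r)} = t i j r`, is the universal such family. -/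
structure RTT (A : Type*) [Ring A] [Algebra ℂ A] (d : ℕ) (p : ℕ → ZMod 2) where
  t : ℕ → ℕ → ℕ → A
  t_zero : ∀ i j, t i j 0 = if i = j then (1 : A) else 0
  rtt : ∀ i j h k r s : ℕ, i < d → j < d → h < d → k < d →
    scomm (sgn ((p i + p j) * (p h + p k))) (t i j r) (t h k s) =
      sgn (p i * p j + p i * p h + p j * p h) •
        ∑ g ∈ Finset.range (min r s),
          (t h j g * t i k (r + s - 1 - g) - t h j (r + s - 1 - g) * t i k g)

/-- Gauss decomposition data `T(u) = F(u) D(u) E(u)` with respect to the composition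
`μ = (μ 0, …, μ (n-1))`, in coefficient form.  `E a b i j r` is the coefficient of
`u^{-r}` in the `(i,j)`-entry of the block `E_{a,b}(u)` (0-based blocks and entries),
extended by the identity on the diagonal blocks and by `0` below them; similarly `F`.
`D a` are the diagonal blocks and `D' a` their inverses.  Since the Gauss
decomposition is unique, this data consists exactly of the quasideterminant blocks. -/
structure Gauss [Ring A] [Algebra ℂ A] (T : ℕ → ℕ → ℕ → A) (n : ℕ) (μ : ℕ → ℕ) where
  D : ℕ → ℕ → ℕ → ℕ → A
  D' : ℕ → ℕ → ℕ → ℕ → A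
  E : ℕ → ℕ → ℕ → ℕ → ℕ → A
  F : ℕ → ℕ → ℕ → ℕ → ℕ → A
  E_diag : ∀ a i j r, E a a i j r = if i = j ∧ r = 0 then 1 else 0
  E_low : ∀ a b i j r, b < a → E a b i j r = 0
  E_zero : ∀ a b i j, a < b → E a b i j 0 = 0
  F_diag : ∀ a i j r, F a a i j r = if i = j ∧ r = 0 then 1 else 0
  F_high : ∀ a b i j r, a < b → F a b i j r = 0
  F_zero : ∀ a b i j, b < a → F a b i j 0 = 0
  D_zero : ∀ a i j, D a i j 0 = if i = j then (1 : A) else 0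
  D_inv : ∀ a i j r, a < n → i < μ a → j < μ a →
    ∑ q ∈ Finset.range (μ a), ∑ e ∈ Finset.range (r + 1), D a i q e * D' a q j (r - e) =
      if i = j ∧ r = 0 then 1 else 0
  D_inv' : ∀ a i j r, a < n → i < μ a → j < μ a →
    ∑ q ∈ Finset.range (μ a), ∑ e ∈ Finset.range (r + 1), D' a i q e * D a q j (r - e) =
      if i = j ∧ r = 0 then 1 else 0
  decomp : ∀ a b i j r, a < n → b < n → i < μ a → j < μ b →
    T (off μ a + i) (off μ b + j) r =
      ∑ c ∈ Finset.range n, ∑ q1 ∈ Finset.range (μ c), ∑ q2 ∈ Finset.range (μ c),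
        ∑ e1 ∈ Finset.range (r + 1), ∑ e2 ∈ Finset.range (r + 1 - e1),
          F a c i q1 e1 * D c q1 q2 e2 * E c b q2 j (r - e1 - e2)

lemma sgn_zero : sgn 0 = 1 := if_pos rfl

lemma sgn_one : sgn 1 = -1 := if_neg one_ne_zero

lemma sgn_add (a b : ZMod 2) : sgn (a + b) = sgn a * sgn b := by
  have h : ∀ x : ZMod 2, x = 0 ∨ x = 1 := by decide
  have h2 : (1 + 1 : ZMod 2) = 0 := by decide
  rcases h a with rfl | rfl <;> rcases h b with rfl | rfl <;> simp [sgn_zero, sgn_one, h2]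

lemma sgn_mul_self (a : ZMod 2) : sgn a * sgn a = 1 := by
  rw [← sgn_add, CharTwo.add_self_eq_zero, sgn_zero]

section Supercommutator

variable {R : Type*} [Ring R] [Algebra ℂ R]

lemma scomm_mul_left (ε₁ ε₂ : ℂ) (x y z : R) :
    scomm (ε₁ * ε₂) (x * y) z = x * scomm ε₂ y z + ε₂ • (scomm ε₁ x z * y) := by
  simp only [scomm, mul_sub, sub_mul, smul_sub, mul_smul_comm, smul_mul_assoc, mul_assoc]
  module

lemma scomm_mul_right (ε₁ ε₂ : ℂ) (x y z : R) :
    scomm (ε₁ * ε₂) x (y * z) = scomm ε₁ x y * z + ε₁ • (y * scomm ε₂ x z) := by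
  simp only [scomm, mul_sub, sub_mul, smul_sub, mul_smul_comm, smul_mul_assoc, mul_assoc]
  module

lemma scomm_sum_left {ι : Type*} (S : Finset ι) (ε : ℂ) (x : ι → R) (y : R) :
    scomm ε (∑ q ∈ S, x q) y = ∑ q ∈ S, scomm ε (x q) y := by
  simp only [scomm, Finset.sum_mul, Finset.mul_sum, Finset.smul_sum, Finset.sum_sub_distrib]

lemma scomm_sum_right {ι : Type*} (S : Finset ι) (ε : ℂ) (x : R) (y : ι → R) :
    scomm ε x (∑ q ∈ S, y q) = ∑ q ∈ S, scomm ε x (y q) := by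
  simp only [scomm, Finset.sum_mul, Finset.mul_sum, Finset.smul_sum, Finset.sum_sub_distrib]

lemma scomm_smul_left (ε c : ℂ) (x y : R) : scomm ε (c • x) y = c • scomm ε x y := by
  simp only [scomm, smul_mul_assoc, mul_smul_comm, smul_sub, smul_comm c]

end Supercommutator

/-- The RTT relations in two variables `u`, `v`, in a ring `R` where `u - v` is replaced by the
formal fraction `e / m` with `e`, `m` central.  The first `n` rows of `T` are factored as the
leading `n × n` block times `E`, and `Q = (E(u) - E(v)) / (u - v)`. -/
structure TwoVar (R : Type*) [Ring R] [Algebra ℂ R] (d n : ℕ) (p : ℕ → ZMod 2) where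
  (tu tv Eu Ev Q : ℕ → ℕ → R)
  (e m : R)
  n_le : n ≤ d
  e_comm : ∀ z, z * e = e * z
  m_comm : ∀ z, z * m = m * z
  e_cancel : ∀ z, e * z = 0 → z = 0
  tu_cancel : ∀ z : ℕ → R, (∀ i < n, ∑ q ∈ Finset.range n, tu i q * z q = 0) → ∀ q < n, z q = 0
  tv_cancel : ∀ z : ℕ → R, (∀ i < n, ∑ q ∈ Finset.range n, tv i q * z q = 0) → ∀ q < n, z q = 0
  rtt : ∀ i j h k, i < d → j < d → h < d → k < d →
    e * scomm (sgn ((p i + p j) * (p h + p k))) (tu i j) (tv h k) =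
      sgn (p i * p j + p i * p h + p j * p h) • (m * (tu h j * tv i k - tv h j * tu i k))
  tu_eq : ∀ i k, i < n → k < d → tu i k = ∑ q ∈ Finset.range n, tu i q * Eu q k
  tv_eq : ∀ i k, i < n → k < d → tv i k = ∑ q ∈ Finset.range n, tv i q * Ev q k
  Ev_diag : ∀ i j, i < n → j < n → Ev i j = if i = j then 1 else 0
  Q_eq : ∀ i j, e * Q i j = m * (Eu i j - Ev i j)

namespace TwoVar

variable {R : Type*} [Ring R] [Algebra ℂ R] {d n : ℕ} {p : ℕ → ZMod 2} (X : TwoVar R d n p)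

lemma mul_e_left (x z : R) : x * (X.e * z) = X.e * (x * z) := by
  rw [← mul_assoc, X.e_comm, mul_assoc]

lemma mul_m_left (x z : R) : x * (X.m * z) = X.m * (x * z) := by
  rw [← mul_assoc, X.m_comm, mul_assoc]

/-- `T(u) (E(u) - E(v)) / (u - v)`. -/
def P (i k : ℕ) : R := ∑ q ∈ Finset.range n, X.tu i q * X.Q q k

lemma e_mul_P (i k : ℕ) (hi : i < n) (hk : k < d) :
    X.e * X.P i k = X.m * (X.tu i k - ∑ q ∈ Finset.range n, X.tu i q * X.Ev q k) := by
  rw [X.tu_eq i k hi hk, P, Finset.mul_sum, ← Finset.sum_sub_distrib, Finset.mul_sum]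
  refine Finset.sum_congr rfl fun q _ => ?_
  rw [← X.mul_e_left, X.Q_eq, X.mul_m_left, mul_sub]

lemma scomm_tu_Ev (i j h k : ℕ) (hi : i < n) (hj : j < d) (hh : h < n) (hk : k < d) :
    scomm (sgn ((p i + p j) * (p h + p k))) (X.tu i j) (X.Ev h k) =
      -(sgn (p i * p j + p i * p h + p j * p h) • (X.Ev h j * X.P i k)) := by
  have hn := X.n_le
  set z : ℕ → R := fun q =>
    sgn ((p i + p j) * p q) •
      (X.e * scomm (sgn ((p i + p j) * (p q + p k))) (X.tu i j) (X.Ev q k)) +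
      sgn (p i * p j) • (X.e * (X.Ev q j * X.P i k)) with hz
  have key : ∀ q < n, z q = 0 := by
    refine X.tv_cancel z fun h hh => ?_
    have term : ∀ q ∈ Finset.range n, X.tv h q * z q =
        sgn ((p i + p j) * p h) •
          (X.e * scomm (sgn ((p i + p j) * (p h + p k))) (X.tu i j) (X.tv h q * X.Ev q k)
          - sgn (p i * p j + p i * p h + p j * p h) •
            (X.m * (X.tu h j * (X.tv i q * X.Ev q k) - X.tv h j * (X.tu i q * X.Ev q k))))
        + sgn (p i * p j) • (X.e * (X.tv h q * X.Ev q j * X.P i k)) := by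
      intro q hq
      have hq := Finset.mem_range.1 hq
      have h1 : sgn ((p i + p j) * (p h + p k)) =
          sgn ((p i + p j) * (p h + p q)) * sgn ((p i + p j) * (p q + p k)) := by
        rw [← sgn_add]
        congr 1
        generalize p i = a, p j = b, p h = c, p k = d, p q = e
        revert a b c d e
        decide
      have h2 : sgn ((p i + p j) * p q) =
          sgn ((p i + p j) * p h) * sgn ((p i + p j) * (p h + p q)) := by
        rw [← sgn_add]
        congr 1
        generalize p i = a, p j = b, p h = c, p q = e
        revert a b c e
        decide
      have h3 := congrArg (· * X.Ev q k)
        (X.rtt i j h q (by omega) hj (by omega) (by omega))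
      simp only [smul_mul_assoc, mul_assoc, sub_mul] at h3
      rw [← h3, h1, scomm_mul_right, hz]
      simp only [mul_add, mul_smul_comm, X.mul_e_left, mul_assoc, h2]
      module
    rw [Finset.sum_congr rfl term, Finset.sum_add_distrib, ← Finset.smul_sum,
      Finset.sum_sub_distrib, ← Finset.smul_sum, ← Finset.mul_sum, ← scomm_sum_right,
      ← X.tv_eq h k hh hk, X.rtt i j h k (by omega) hj (by omega) hk, ← Finset.mul_sum,
      Finset.sum_sub_distrib, ← Finset.mul_sum, ← Finset.mul_sum, ← X.tv_eq i k hi hk,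
      ← Finset.smul_sum, ← Finset.mul_sum, ← Finset.sum_mul, ← X.tv_eq h j hh hj,
      ← X.mul_e_left, X.e_mul_P i k hi hk]
    have h4 : sgn (p i * p j) =
        sgn ((p i + p j) * p h) * sgn (p i * p j + p i * p h + p j * p h) := by
      rw [← sgn_add]
      congr 1
      generalize p i = a, p j = b, p h = c
      revert a b c
      decide
    rw [h4, X.mul_m_left]
    simp only [mul_sub]
    module
  have hzh := key h hh
  rw [← sub_eq_zero]
  refine X.e_cancel _ ?_
  have h5 : sgn (p i * p j + p i * p h + p j * p h) =
        sgn ((p i + p j) * p h) * sgn (p i * p j) := by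
    rw [← sgn_add]
    congr 1
    ring
  have h6 := congrArg (sgn ((p i + p j) * p h) • ·) hzh
  simp only [hz, smul_add, smul_smul, sgn_mul_self, one_smul, smul_zero] at h6
  rw [h5, sub_neg_eq_add, mul_add, mul_smul_comm]
  exact h6

/-- `[Q_{ij}, E_{hk}(v)]` corrected by the failure of `T(u)` to commute with `E(v)`. -/
def V (i j h k : ℕ) : R :=
  scomm (sgn ((p i + p j) * (p h + p k))) (X.Q i j) (X.Ev h k) -
    sgn (p h * p j + p h * p k + p j * p k) • (X.Q i k * X.Q h j)

lemma sum_tu_Ev_mul (F : ℕ → R) (i j h k : ℕ) (hi : i < n) (hh : h < n) (hk : k < d) :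
    ∑ q ∈ Finset.range n, sgn ((p q + p j) * (p h + p k)) •
      (scomm (sgn ((p i + p q) * (p h + p k))) (X.tu i q) (X.Ev h k) * F q) =
    -(sgn (p h * p j + p h * p k + p j * p k) • (X.P i k * F h)) := by
  have hn := X.n_le
  rw [Finset.sum_eq_single h]
  · rw [X.scomm_tu_Ev i h h k hi (by omega) hh hk, X.Ev_diag h h hh hh, if_pos rfl, one_mul,
      neg_mul, smul_neg, smul_mul_assoc, smul_smul, ← sgn_add]
    congr 3
    generalize p i = a, p j = b, p h = c, p k = d
    revert a b c d
    decide
  · intro q hq hqh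
    have hq := Finset.mem_range.1 hq
    rw [X.scomm_tu_Ev i q h k hi (by omega) hh hk, X.Ev_diag h q hh hq, if_neg (Ne.symm hqh)]
    simp
  · intro hq
    exact absurd (Finset.mem_range.2 hh) hq

lemma scomm_sum_tu_mul (F : ℕ → R) (i j h k : ℕ) (hi : i < n) (hh : h < n) (hk : k < d) :
    scomm (sgn ((p i + p j) * (p h + p k))) (∑ q ∈ Finset.range n, X.tu i q * F q) (X.Ev h k) =
      ∑ q ∈ Finset.range n,
        X.tu i q * scomm (sgn ((p q + p j) * (p h + p k))) (F q) (X.Ev h k) -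
      sgn (p h * p j + p h * p k + p j * p k) • (X.P i k * F h) := by
  rw [scomm_sum_left, sub_eq_add_neg, ← X.sum_tu_Ev_mul F i j h k hi hh hk,
    ← Finset.sum_add_distrib]
  refine Finset.sum_congr rfl fun q _ => ?_
  rw [← scomm_mul_left, ← sgn_add]
  congr 2
  generalize p i = a, p j = b, p h = c, p k = d, p q = e
  revert a b c d e
  decide

lemma scomm_P_Ev (i j h k : ℕ) (hi : i < n) (hh : h < n) (hk : k < d) :
    scomm (sgn ((p i + p j) * (p h + p k))) (X.P i j) (X.Ev h k) =
      ∑ q ∈ Finset.range n, X.tu i q * X.V q j h k := by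
  rw [P, X.scomm_sum_tu_mul _ i j h k hi hh hk, P, Finset.sum_mul, Finset.smul_sum,
    ← Finset.sum_sub_distrib]
  refine Finset.sum_congr rfl fun q _ => ?_
  rw [V, mul_sub, mul_smul_comm, mul_assoc]

lemma e_mul_V (i j h k : ℕ) (hi : i < n) (hj : j < d) (hh : h < n) (hk : k < d) :
    X.e * X.V i j h k = X.m *
      (sgn (p h * p j + p h * p k + p j * p k) • X.V i k h j -
        scomm (sgn ((p i + p j) * (p h + p k))) (X.Ev i j) (X.Ev h k)) := by
  rw [← sub_eq_zero]
  refine X.tu_cancel (fun i => X.e * X.V i j h k - X.m *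
      (sgn (p h * p j + p h * p k + p j * p k) • X.V i k h j -
        scomm (sgn ((p i + p j) * (p h + p k))) (X.Ev i j) (X.Ev h k))) (fun i hi => ?_) i hi
  simp only [mul_sub, Finset.sum_sub_distrib, X.mul_e_left, X.mul_m_left, mul_smul_comm,
    ← Finset.mul_sum, ← Finset.smul_sum]
  rw [← X.scomm_P_Ev i j h k hi hh hk, ← X.scomm_P_Ev i k h j hi hh hj]
  have h1 := X.scomm_sum_tu_mul (fun q => X.Ev q j) i j h k hi hh hk
  have h2 := X.scomm_tu_Ev i j h k hi hj hh hk
  have h3 : X.e * scomm (sgn ((p i + p j) * (p h + p k))) (X.P i j) (X.Ev h k) =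
      X.m * scomm (sgn ((p i + p j) * (p h + p k)))
        (X.tu i j - ∑ q ∈ Finset.range n, X.tu i q * X.Ev q j) (X.Ev h k) := by
    simp only [scomm, mul_sub, ← mul_assoc, mul_smul_comm, X.e_mul_P i j hi hj]
    simp only [mul_assoc, ← X.mul_e_left, X.e_mul_P i j hi hj, X.mul_m_left]
    simp only [mul_sub, sub_mul, mul_assoc]
  have h4 : scomm (sgn ((p i + p j) * (p h + p k)))
        (X.tu i j - ∑ q ∈ Finset.range n, X.tu i q * X.Ev q j) (X.Ev h k) =
      scomm (sgn ((p i + p j) * (p h + p k))) (X.tu i j) (X.Ev h k) -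
      scomm (sgn ((p i + p j) * (p h + p k)))
        (∑ q ∈ Finset.range n, X.tu i q * X.Ev q j) (X.Ev h k) := by
    simp only [scomm, mul_sub, sub_mul, smul_sub]
    abel
  have h5 : sgn (p i * p j + p i * p h + p j * p h) =
      sgn (p h * p j + p h * p k + p j * p k) * sgn ((p i + p k) * (p h + p j)) := by
    rw [← sgn_add]
    congr 1
    generalize p i = a, p j = b, p h = c, p k = d
    revert a b c d
    decide
  rw [h3, h4, h1, h2, h5]
  simp only [scomm, mul_sub, mul_add, mul_neg, smul_sub, mul_smul_comm, Finset.mul_sum,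
    Finset.sum_sub_distrib]
  module

/-- If the corrected brackets vanish then so does `[[t_{ij}(u), E_{hk}(v)], E_{fg}(v)]`. -/
lemma scomm_scomm_tu (hV : ∀ i j h k, i < n → j < d → h < n → k < d → X.V i j h k = 0)
    (i j h k f g : ℕ) (hi : i < n) (hj : j < n) (hh : h < n) (hk : k < d) (hf : f < n)
    (hg : g < d) :
    scomm (sgn ((p i + p j + p h + p k) * (p f + p g)))
      (scomm (sgn ((p i + p j) * (p h + p k))) (X.tu i j) (X.Ev h k)) (X.Ev f g) = 0 := by
  have hn := X.n_le
  rw [X.scomm_tu_Ev i j h k hi (by omega) hh hk, X.Ev_diag h j hh hj]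
  split_ifs with hhj
  · subst hhj
    have h1 : (p i + p h + p h + p k) * (p f + p g) = (p i + p k) * (p f + p g) := by
      rw [add_assoc (p i), CharTwo.add_self_eq_zero, add_zero]
    rw [h1, one_mul, ← neg_smul, scomm_smul_left, X.scomm_P_Ev i k f g hi hf hg,
      Finset.sum_eq_zero, smul_zero]
    intro q hq
    rw [hV q k f g (Finset.mem_range.1 hq) hk hf hg, mul_zero]
  · simp [scomm]

lemma scomm_tu_of_ne (i j h k : ℕ) (hi : i < n) (hj : j < n) (hh : h < n) (hk : k < d)
    (hne : h ≠ j) :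
    scomm (sgn ((p i + p j) * (p h + p k))) (X.tu i j) (X.Ev h k) = 0 := by
  have hn := X.n_le
  rw [X.scomm_tu_Ev i j h k hi (by omega) hh hk, X.Ev_diag h j hh hj, if_neg hne]
  simp

end TwoVar

section PowerSeries

open PowerSeries

variable [Ring A]

/-- A system of power series whose matrix of constant terms is the identity can be cancelled on
the left. -/
lemma eq_zero_of_sum_mul_eq_zero {n : ℕ} (B : ℕ → ℕ → A⟦X⟧) (z : ℕ → A⟦X⟧)
    (hB : ∀ i < n, ∀ j < n, coeff 0 (B i j) = if i = j then 1 else 0)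
    (h : ∀ i < n, ∑ q ∈ Finset.range n, B i q * z q = 0) : ∀ q < n, z q = 0 := by
  suffices H : ∀ r, ∀ q < n, coeff r (z q) = 0 from
    fun q hq => PowerSeries.ext fun r => by rw [H r q hq, map_zero]
  intro r
  induction r using Nat.strong_induction_on with
  | _ r ih =>
    intro i hi
    have h1 := congrArg (coeff r) (h i hi)
    rw [map_sum, map_zero] at h1
    rw [← h1, Finset.sum_eq_single i]
    · rw [coeff_mul, Finset.sum_eq_single (0, r)]
      · simp only [hB i hi i hi, if_true, one_mul]
      · rintro ⟨a, b⟩ hab hne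
        rw [Finset.HasAntidiagonal.mem_antidiagonal] at hab
        have hb : b < r := by
          rcases Nat.eq_zero_or_pos a with rfl | ha
          · exact absurd (by simp at hab; simp [hab]) hne
          · simp only at hab; omega
        simp only [ih b hb i hi, mul_zero]
      · intro hr
        exact absurd (Finset.HasAntidiagonal.mem_antidiagonal.2 (zero_add r)) hr
    · intro q hq hqi
      have hq := Finset.mem_range.1 hq
      rw [coeff_mul]
      refine Finset.sum_eq_zero ?_
      rintro ⟨a, b⟩ hab
      rw [Finset.HasAntidiagonal.mem_antidiagonal] at hab
      simp only at hab ⊢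
      rcases Nat.eq_zero_or_pos a with rfl | ha
      · rw [hB i hi q hq, if_neg (Ne.symm hqi), zero_mul]
      · rw [ih b (by omega) q hq, mul_zero]
    · intro hr
      exact absurd (Finset.mem_range.2 hi) hr

/-- View a series in `u⁻¹` as a series in `u⁻¹` and `v⁻¹`. -/
def inU : A⟦X⟧ →+* A⟦X⟧⟦X⟧ := C

/-- View a series in `v⁻¹` as a series in `u⁻¹` and `v⁻¹`. -/
def inV : A⟦X⟧ →+* A⟦X⟧⟦X⟧ := PowerSeries.map C

lemma ext₂ {f g : A⟦X⟧⟦X⟧} (h : ∀ r s, coeff r (coeff s f) = coeff r (coeff s g)) : f = g :=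
  PowerSeries.ext fun s => PowerSeries.ext fun r => h r s

lemma coeff_inU_mul (r s : ℕ) (f : A⟦X⟧) (z : A⟦X⟧⟦X⟧) :
    coeff r (coeff s (inU f * z)) = coeff r (f * coeff s z) := by
  rw [inU, coeff_C_mul]

lemma coeff_inU_mul_inV (r s : ℕ) (f g : A⟦X⟧) :
    coeff r (coeff s (inU f * inV g)) = coeff r f * coeff s g := by
  rw [inU, inV, coeff_C_mul, coeff_map, coeff_mul_C]

lemma coeff_inV_mul_inU (r s : ℕ) (f g : A⟦X⟧) :
    coeff r (coeff s (inV g * inU f)) = coeff s g * coeff r f := by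
  rw [inU, inV, coeff_mul_C, coeff_map, coeff_C_mul]

lemma inU_X_comm (z : A⟦X⟧⟦X⟧) : z * inU X = inU X * z := by
  ext s : 1
  rw [inU, coeff_C_mul, coeff_mul_C, X_mul]

/-- Two-variable series agree after multiplication by `(v⁻¹ - u⁻¹)` and `u⁻¹v⁻¹` respectively
iff they satisfy the corresponding recursion. -/
lemma diff_mul_eq_iff (f g : A⟦X⟧⟦X⟧) :
    (X - inU X) * f = inU X * X * g ↔
      (∀ s, coeff 0 (coeff s f) = 0) ∧ (∀ r, coeff r (coeff 0 f) = 0) ∧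
      ∀ r s, coeff (r + 1) (coeff s f) - coeff r (coeff (s + 1) f) = coeff r (coeff s g) := by
  have h00 : ∀ r, coeff r (coeff 0 ((X - inU X) * f)) =
      - coeff r (X * coeff 0 f) := by
    intro r
    rw [sub_mul, map_sub, map_sub, coeff_zero_X_mul, map_zero, zero_sub, coeff_inU_mul]
  have h0s : ∀ s, coeff 0 (coeff (s + 1) ((X - inU X) * f)) = coeff 0 (coeff s f) := by
    intro s
    rw [sub_mul, map_sub, map_sub, coeff_succ_X_mul, coeff_inU_mul, coeff_zero_X_mul, sub_zero]
  have hrs : ∀ r s, coeff (r + 1) (coeff (s + 1) ((X - inU X) * f)) =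
      coeff (r + 1) (coeff s f) - coeff r (coeff (s + 1) f) := by
    intro r s
    rw [sub_mul, map_sub, map_sub, coeff_succ_X_mul, coeff_inU_mul, coeff_succ_X_mul]
  have k00 : ∀ r, coeff r (coeff 0 (inU X * X * g)) = 0 := by
    intro r
    rw [mul_assoc, coeff_inU_mul, coeff_zero_X_mul, mul_zero, map_zero]
  have k0s : ∀ s, coeff 0 (coeff s (inU X * X * g)) = 0 := by
    intro s
    rw [mul_assoc, coeff_inU_mul, coeff_zero_X_mul]
  have krs : ∀ r s, coeff (r + 1) (coeff (s + 1) (inU X * X * g)) = coeff r (coeff s g) := by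
    intro r s
    rw [mul_assoc, coeff_inU_mul, coeff_succ_X_mul, coeff_succ_X_mul]
  constructor
  · intro h
    refine ⟨fun s => ?_, fun r => ?_, fun r s => ?_⟩
    · rw [← h0s, h, k0s]
    · rw [← coeff_succ_X_mul r, ← neg_eq_zero, ← h00, h, k00]
    · rw [← hrs, h, krs]
  · rintro ⟨h1, h2, h3⟩
    refine ext₂ fun r s => ?_
    rcases s with _ | s
    · rw [h00, k00, neg_eq_zero]
      rcases r with _ | r
      · rw [coeff_zero_X_mul]
      · rw [coeff_succ_X_mul, h2]
    · rcases r with _ | r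
      · rw [h0s, k0s, h1]
      · rw [hrs, krs, h3]

lemma diff_mul_cancel (f : A⟦X⟧⟦X⟧) (h : (X - inU X) * f = 0) : f = 0 := by
  obtain ⟨h1, -, h3⟩ := (diff_mul_eq_iff f 0).1 (by rw [h, mul_zero])
  refine ext₂ fun r => ?_
  induction r with
  | zero => intro s; rw [h1, map_zero, map_zero]
  | succ r ih =>
    intro s
    have := h3 r s
    rw [ih (s + 1)] at this
    simpa using this

/-- The divided difference `(f(u) - f(v)) / (u - v)`. -/
def divDiff (f : A⟦X⟧) : A⟦X⟧⟦X⟧ :=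
  PowerSeries.mk fun s => PowerSeries.mk fun r =>
    if r = 0 ∨ s = 0 then 0 else -coeff (r + s - 1) f

lemma coeff_divDiff (f : A⟦X⟧) (r s : ℕ) :
    coeff r (coeff s (divDiff f)) = if r = 0 ∨ s = 0 then 0 else -coeff (r + s - 1) f := by
  rw [divDiff, coeff_mk, coeff_mk]

lemma diff_mul_divDiff (f : A⟦X⟧) :
    (X - inU X) * divDiff f = inU X * X * (inU f - inV f) := by
  rw [diff_mul_eq_iff]
  refine ⟨fun s => by simp [coeff_divDiff], fun r => by rw [coeff_divDiff, if_pos (Or.inr rfl)], fun r s => ?_⟩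
  simp only [coeff_divDiff, map_sub, inU, inV, coeff_C, coeff_map]
  rcases r with _ | r <;> rcases s with _ | s
  · simp
  · simp
  · simp
  · have e1 : r + 1 + 1 + (s + 1) - 1 = r + s + 2 := by omega
    have e2 : r + 1 + (s + 1 + 1) - 1 = r + s + 2 := by omega
    simp [e1, e2]

end PowerSeries

section Coefficients

open PowerSeries

variable [Ring A] [Algebra ℂ A]

lemma coeff_scomm_inU_inV (ε : ℂ) (r s : ℕ) (f g : A⟦X⟧) :
    coeff r (coeff s (scomm ε (inU f) (inV g))) = scomm ε (coeff r f) (coeff s g) := by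
  simp only [scomm, map_sub, coeff_smul, coeff_inU_mul_inV, coeff_inV_mul_inU]

lemma coeff_scomm_inV (ε : ℂ) (r s : ℕ) (z : A⟦X⟧⟦X⟧) (g : A⟦X⟧) :
    coeff r (coeff s (scomm ε z (inV g))) =
      ∑ c ∈ Finset.range (s + 1), scomm ε (coeff r (coeff c z)) (coeff (s - c) g) := by
  rw [← Finset.Nat.sum_antidiagonal_eq_sum_range_succ
    (fun a b => scomm ε (coeff r (coeff a z)) (coeff b g))]
  simp only [scomm, map_sub, coeff_smul, Finset.sum_sub_distrib, ← Finset.smul_sum]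
  congr 2
  · rw [coeff_mul, map_sum]
    simp only [inV, coeff_map, coeff_mul_C]
  · rw [coeff_mul, map_sum, ← Finset.Nat.sum_antidiagonal_swap]
    simp only [inV, coeff_map, coeff_C_mul, Prod.fst_swap, Prod.snd_swap]

variable {d : ℕ} {p : ℕ → ZMod 2}

/-- The generating series `t_{ij}(u)`. -/
def RTT.ser (S : RTT A d p) (i j : ℕ) : A⟦X⟧ := PowerSeries.mk (S.t i j)

lemma RTT.scomm_succ (S : RTT A d p) (i j h k r s : ℕ) (hi : i < d) (hj : j < d) (hh : h < d)
    (hk : k < d) :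
    scomm (sgn ((p i + p j) * (p h + p k))) (S.t i j (r + 1)) (S.t h k s) -
      scomm (sgn ((p i + p j) * (p h + p k))) (S.t i j r) (S.t h k (s + 1)) =
    sgn (p i * p j + p i * p h + p j * p h) •
      (S.t h j r * S.t i k s - S.t h j s * S.t i k r) := by
  rw [S.rtt i j h k _ _ hi hj hh hk, S.rtt i j h k _ _ hi hj hh hk, ← smul_sub]
  congr 1
  rw [show r + 1 + s - 1 = r + s by omega, show r + (s + 1) - 1 = r + s by omega]
  rcases lt_trichotomy r s with hrs | rfl | hrs
  · rw [min_eq_left (by omega : r + 1 ≤ s), min_eq_left (by omega : r ≤ s + 1),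
      Finset.sum_range_succ, add_sub_cancel_left, Nat.add_sub_cancel_left]
  · rw [min_eq_right (by omega : r ≤ r + 1), min_eq_left (by omega : r ≤ r + 1)]
    simp
  · rw [min_eq_right (by omega : s ≤ r + 1), min_eq_right (by omega : s + 1 ≤ r),
      Finset.sum_range_succ, Nat.add_sub_cancel]
    abel

lemma RTT.rtt_ser (S : RTT A d p) (i j h k : ℕ) (hi : i < d) (hj : j < d) (hh : h < d)
    (hk : k < d) :
    (X - inU X) * scomm (sgn ((p i + p j) * (p h + p k))) (inU (S.ser i j)) (inV (S.ser h k)) =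
      sgn (p i * p j + p i * p h + p j * p h) • (inU X * X *
        (inU (S.ser h j) * inV (S.ser i k) - inV (S.ser h j) * inU (S.ser i k))) := by
  rw [← mul_smul_comm, diff_mul_eq_iff]
  simp only [coeff_scomm_inU_inV, coeff_smul, map_sub, coeff_inU_mul_inV, coeff_inV_mul_inU,
    RTT.ser, coeff_mk]
  refine ⟨fun s => ?_, fun r => ?_, fun r s => S.scomm_succ i j h k r s hi hj hh hk⟩
  · rw [S.rtt i j h k _ _ hi hj hh hk]; simp
  · rw [S.rtt i j h k _ _ hi hj hh hk]; simp

/-- The two-variable relations attached to a factorization of the first `n` rows of `T(u)`. -/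
def RTT.twoVar (S : RTT A d p) (n : ℕ) (hn : n ≤ d) (E : ℕ → ℕ → A⟦X⟧)
    (hE : ∀ i k, i < n → k < d → S.ser i k = ∑ q ∈ Finset.range n, S.ser i q * E q k)
    (hdiag : ∀ i j, i < n → j < n → E i j = if i = j then 1 else 0) :
    TwoVar A⟦X⟧⟦X⟧ d n p where
  tu i j := inU (S.ser i j)
  tv i j := inV (S.ser i j)
  Eu i j := inU (E i j)
  Ev i j := inV (E i j)
  Q i j := divDiff (E i j)
  e := X - inU X
  m := inU X * X
  n_le := hn
  e_comm z := by rw [mul_sub, sub_mul, inU_X_comm, X_mul]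
  m_comm z := by rw [← mul_assoc, inU_X_comm, mul_assoc, mul_assoc, X_mul]
  e_cancel := diff_mul_cancel
  tu_cancel z h q hq := by
    refine PowerSeries.ext fun s => ?_
    rw [map_zero]
    refine eq_zero_of_sum_mul_eq_zero (fun i j => S.ser i j) (fun q => coeff s (z q))
      (fun i _ j _ => by rw [RTT.ser, coeff_mk, S.t_zero]) (fun i hi => ?_) q hq
    have := congrArg (coeff s) (h i hi)
    simpa [inU, coeff_C_mul] using this
  tv_cancel z h q hq := by
    refine eq_zero_of_sum_mul_eq_zero (fun i j => inV (S.ser i j)) z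
      (fun i _ j _ => ?_) h q hq
    rw [inV, coeff_map, RTT.ser, coeff_mk, S.t_zero]
    split_ifs <;> simp
  rtt := S.rtt_ser
  tu_eq i k hi hk := by rw [hE i k hi hk]; simp only [map_sum, map_mul]
  tv_eq i k hi hk := by rw [hE i k hi hk]; simp only [map_sum, map_mul]
  Ev_diag i j hi hj := by rw [hdiag i j hi hj]; split_ifs <;> simp
  Q_eq i j := diff_mul_divDiff _

lemma RTT.twoVar_V (S : RTT A d p) (n : ℕ) (hn : n ≤ d) (E : ℕ → ℕ → A⟦X⟧)
    (hE : ∀ i k, i < n → k < d → S.ser i k = ∑ q ∈ Finset.range n, S.ser i q * E q k)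
    (hdiag : ∀ i j, i < n → j < n → E i j = if i = j then 1 else 0)
    (i j h k : ℕ) (hi : i < n) (hj : j < d) (hh : h < n) (hk : k < d) :
    (S.twoVar n hn E hE hdiag).V i j h k = 0 := by
  set Y := S.twoVar n hn E hE hdiag
  have hrec : ∀ j k, j < d → k < d → (∀ s, coeff 0 (coeff s (Y.V i j h k)) = 0) ∧
      (∀ r, coeff r (coeff 0 (Y.V i j h k)) = 0) ∧
      ∀ r s, coeff (r + 1) (coeff s (Y.V i j h k)) - coeff r (coeff (s + 1) (Y.V i j h k)) =
        coeff r (coeff s (sgn (p h * p j + p h * p k + p j * p k) • Y.V i k h j -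
          scomm (sgn ((p i + p j) * (p h + p k))) (Y.Ev i j) (Y.Ev h k))) :=
    fun j k hj hk => (diff_mul_eq_iff _ _).1 (Y.e_mul_V i j h k hi hj hh hk)
  have hconst : ∀ (ε : ℂ) r s (f g : A⟦X⟧),
      coeff (r + 1) (coeff s (scomm ε (inV f) (inV g))) = 0 := by
    intro ε r s f g
    have : scomm ε (inV f) (inV g) = inV (scomm ε f g) := by
      refine PowerSeries.ext fun s => ?_
      simp only [scomm, ← map_mul, map_sub, coeff_smul, inV, coeff_map]
      congr 1
      refine PowerSeries.ext fun r => ?_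
      rcases r with _ | r <;> simp [coeff_C]
    rw [this, inV, coeff_map, coeff_succ_C]
  have main : ∀ s r j k, j < d → k < d → coeff r (coeff s (Y.V i j h k)) = 0 := by
    intro s
    induction s with
    | zero => intro r j k hj hk; exact (hrec j k hj hk).2.1 r
    | succ s ih =>
      intro r j k hj hk
      rcases r with _ | r
      · exact (hrec j k hj hk).1 _
      · have h3 := (hrec j k hj hk).2.2 (r + 1) s
        rw [ih _ j k hj hk, map_sub, map_sub, coeff_smul, coeff_smul, ih _ k j hk hj, smul_zero,
          zero_sub, zero_sub, neg_inj] at h3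
        rw [h3]
        exact hconst _ r s _ _
  exact ext₂ fun r s => by rw [main s r j k hj hk, map_zero, map_zero]

end Coefficients

section ThreeBlocks

open PowerSeries

lemma off_zero (μ : ℕ → ℕ) : off μ 0 = 0 := rfl

lemma off_one (μ : ℕ → ℕ) : off μ 1 = μ 0 := by simp [off]

lemma off_two (μ : ℕ → ℕ) : off μ 2 = μ 0 + μ 1 := by simp [off, Finset.sum_range_succ]

lemma off_three (μ : ℕ → ℕ) : off μ 3 = μ 0 + μ 1 + μ 2 := by simp [off, Finset.sum_range_succ]

namespace Gauss

variable [Ring A] [Algebra ℂ A]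

variable {T : ℕ → ℕ → ℕ → A} {n : ℕ} {μ : ℕ → ℕ}

/-- The generating series of the entries of the block `E_{a,b}`. -/
def serE (G : Gauss T n μ) (a b i j : ℕ) : A⟦X⟧ := PowerSeries.mk (G.E a b i j)

lemma serE_diag (G : Gauss T n μ) (a i j : ℕ) : G.serE a a i j = if i = j then 1 else 0 := by
  ext r
  rw [serE, coeff_mk, G.E_diag]
  by_cases hij : i = j <;> simp [hij, coeff_one]

lemma serE_low (G : Gauss T n μ) (a b i j : ℕ) (h : b < a) : G.serE a b i j = 0 := by
  ext r
  rw [serE, coeff_mk, G.E_low _ _ _ _ _ h, map_zero]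

lemma mk_F_diag (G : Gauss T n μ) (a i j : ℕ) :
    PowerSeries.mk (G.F a a i j) = if i = j then 1 else 0 := by
  ext r
  rw [coeff_mk, G.F_diag]
  by_cases hij : i = j <;> simp [hij, coeff_one]

lemma mk_F_high (G : Gauss T n μ) (a b i j : ℕ) (h : a < b) :
    PowerSeries.mk (G.F a b i j) = 0 := by
  ext r
  rw [coeff_mk, G.F_high _ _ _ _ _ h, map_zero]

lemma ser_decomp (G : Gauss T n μ) (a b i j : ℕ) (ha : a < n) (hb : b < n) (hi : i < μ a)
    (hj : j < μ b) :
    PowerSeries.mk (T (off μ a + i) (off μ b + j)) =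
      ∑ c ∈ Finset.range n, ∑ q₂ ∈ Finset.range (μ c), (∑ q₁ ∈ Finset.range (μ c),
        PowerSeries.mk (G.F a c i q₁) * PowerSeries.mk (G.D c q₁ q₂)) * G.serE c b q₂ j := by
  ext r
  rw [coeff_mk, G.decomp a b i j r ha hb hi hj, map_sum]
  refine Finset.sum_congr rfl fun c _ => ?_
  rw [Finset.sum_comm, map_sum]
  refine Finset.sum_congr rfl fun q₂ _ => ?_
  rw [Finset.sum_mul, map_sum]
  refine Finset.sum_congr rfl fun q₁ _ => ?_
  rw [mul_assoc, coeff_mul, Finset.Nat.sum_antidiagonal_eq_sum_range_succ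
    (fun x y => coeff x (PowerSeries.mk (G.F a c i q₁)) *
      coeff y (PowerSeries.mk (G.D c q₁ q₂) * G.serE c b q₂ j))]
  refine Finset.sum_congr rfl fun e₁ he₁ => ?_
  rw [Finset.mem_range] at he₁
  rw [coeff_mul, Finset.Nat.sum_antidiagonal_eq_sum_range_succ
    (fun x y => coeff x (PowerSeries.mk (G.D c q₁ q₂)) * coeff y (G.serE c b q₂ j)),
    Finset.mul_sum, show r + 1 - e₁ = (r - e₁) + 1 by omega]
  refine Finset.sum_congr rfl fun e₂ _ => ?_
  simp only [serE, coeff_mk, mul_assoc]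

/-- The first two block rows of `T(u)` in terms of the first block column and `E(u)`. -/
lemma exists_row (G : Gauss T 3 μ) (i : ℕ) (hi : i < μ 0 + μ 1) :
    ∃ H : ℕ → A⟦X⟧, (i < μ 0 → H = 0) ∧ ∀ b j, b < 3 → j < μ b →
      PowerSeries.mk (T i (off μ b + j)) =
        ∑ q ∈ Finset.range (μ 0), PowerSeries.mk (T i q) * G.serE 0 b q j +
        ∑ q ∈ Finset.range (μ 1), H q * G.serE 1 b q j := by
  obtain ⟨K, H, hH, hrow⟩ : ∃ K H : ℕ → A⟦X⟧, (i < μ 0 → H = 0) ∧ ∀ b j, b < 3 → j < μ b →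
      PowerSeries.mk (T i (off μ b + j)) =
        ∑ q ∈ Finset.range (μ 0), K q * G.serE 0 b q j +
        ∑ q ∈ Finset.range (μ 1), H q * G.serE 1 b q j := by
    rcases lt_or_ge i (μ 0) with h0 | h0
    · refine ⟨fun q => PowerSeries.mk (G.D 0 i q), 0, fun _ => rfl, fun b j hb hj => ?_⟩
      have := G.ser_decomp 0 b i j (by omega) hb h0 hj
      rw [off_zero, zero_add] at this
      rw [this]
      simp [Finset.sum_range_succ _ 2, Finset.sum_range_succ _ 1, mk_F_diag, mk_F_high, h0]
    · obtain ⟨l, rfl⟩ := Nat.exists_eq_add_of_le h0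
      have hl : l < μ 1 := by omega
      refine ⟨fun q => ∑ q₁ ∈ Finset.range (μ 0),
          PowerSeries.mk (G.F 1 0 l q₁) * PowerSeries.mk (G.D 0 q₁ q),
        fun q => PowerSeries.mk (G.D 1 l q), fun h => absurd h (by omega), fun b j hb hj => ?_⟩
      have := G.ser_decomp 1 b l j (by omega) hb hl hj
      rw [off_one] at this
      rw [this]
      simp [Finset.sum_range_succ _ 2, Finset.sum_range_succ _ 1, mk_F_diag, mk_F_high, hl]
  refine ⟨H, hH, fun b j hb hj => ?_⟩
  rw [hrow b j hb hj]
  congr 1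
  refine Finset.sum_congr rfl fun q hq => ?_
  have hq := Finset.mem_range.1 hq
  have := hrow 0 q (by omega) hq
  rw [off_zero, zero_add] at this
  rw [this]
  simp [serE_diag, serE_low, hq]

/-- The first two block rows of `T(u)` factor as the leading block of size `μ 0 + μ 1` times
the matrix with these entries. -/
def topE (G : Gauss T 3 μ) (i k : ℕ) : A⟦X⟧ :=
  if k < μ 0 + μ 1 then (if i = k then 1 else 0)
  else if i < μ 0 then
    G.serE 0 2 i (k - (μ 0 + μ 1)) -
      ∑ q ∈ Finset.range (μ 1), G.serE 0 1 i q * G.serE 1 2 q (k - (μ 0 + μ 1))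
  else G.serE 1 2 (i - μ 0) (k - (μ 0 + μ 1))

lemma topE_diag (G : Gauss T 3 μ) (i j : ℕ) (hj : j < μ 0 + μ 1) :
    G.topE i j = if i = j then 1 else 0 := if_pos hj

lemma topE_add (G : Gauss T 3 μ) (h k : ℕ) :
    G.topE (μ 0 + h) (μ 0 + μ 1 + k) = G.serE 1 2 h k := by
  rw [topE, if_neg (by omega), if_neg (by omega), Nat.add_sub_cancel_left,
    Nat.add_sub_cancel_left]

lemma ser_eq_sum_topE (G : Gauss T 3 μ) (i k : ℕ) (hi : i < μ 0 + μ 1)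
    (hk : k < μ 0 + μ 1 + μ 2) :
    PowerSeries.mk (T i k) =
      ∑ q ∈ Finset.range (μ 0 + μ 1), PowerSeries.mk (T i q) * G.topE q k := by
  rcases lt_or_ge k (μ 0 + μ 1) with h | h
  · simp [topE_diag _ _ _ h, h]
  obtain ⟨l, rfl⟩ := Nat.exists_eq_add_of_le h
  have hl : l < μ 2 := by omega
  obtain ⟨H, -, hrow⟩ := G.exists_row i hi
  have h2 := hrow 2 l (by omega) hl
  rw [off_two] at h2
  have h1 : ∀ q ∈ Finset.range (μ 1),
      PowerSeries.mk (T i (μ 0 + q)) * G.topE (μ 0 + q) (μ 0 + μ 1 + l) =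
      (∑ a ∈ Finset.range (μ 0), PowerSeries.mk (T i a) * (G.serE 0 1 a q * G.serE 1 2 q l)) +
        H q * G.serE 1 2 q l := by
    intro q hq
    have hq := Finset.mem_range.1 hq
    have := hrow 1 q (by omega) hq
    rw [off_one] at this
    rw [this, topE_add, add_mul, Finset.sum_mul]
    simp [serE_diag, hq, mul_assoc]
  have h0 : ∀ q ∈ Finset.range (μ 0),
      PowerSeries.mk (T i q) * G.topE q (μ 0 + μ 1 + l) =
      PowerSeries.mk (T i q) * G.serE 0 2 q l -
        ∑ a ∈ Finset.range (μ 1), PowerSeries.mk (T i q) * (G.serE 0 1 q a * G.serE 1 2 a l) := by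
    intro q hq
    rw [topE, if_neg (by omega), if_pos (Finset.mem_range.1 hq), Nat.add_sub_cancel_left, mul_sub,
      Finset.mul_sum]
  rw [h2, Finset.sum_range_add, Finset.sum_congr rfl h0, Finset.sum_congr rfl h1,
    Finset.sum_sub_distrib, Finset.sum_add_distrib, Finset.sum_comm (s := Finset.range (μ 1))]
  abel

end Gauss

variable [Ring A] [Algebra ℂ A]

/-- The Serre-type relation for the generating series in two variables. -/
lemma scomm_scomm_serE {d : ℕ} {p : ℕ → ZMod 2} {μ : ℕ → ℕ}
    (S : RTT A d p) (G : Gauss S.t 3 μ) (hd : off μ 3 = d) (i j h k f g : ℕ)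
    (hi : i < μ 0) (hj : j < μ 1) (hh : h < μ 1) (hk : k < μ 2) (hf : f < μ 1) (hg : g < μ 2) :
    scomm
      (sgn ((p i + p (μ 0 + j) + p (μ 0 + h) + p (μ 0 + μ 1 + k)) *
        (p (μ 0 + f) + p (μ 0 + μ 1 + g))))
      (scomm (sgn ((p i + p (μ 0 + j)) * (p (μ 0 + h) + p (μ 0 + μ 1 + k))))
        (inU (G.serE 0 1 i j)) (inV (G.serE 1 2 h k)))
      (inV (G.serE 1 2 f g)) = 0 := by
  rw [off_three] at hd
  subst hd
  have hE : ∀ i k, i < μ 0 + μ 1 → k < μ 0 + μ 1 + μ 2 →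
      S.ser i k = ∑ q ∈ Finset.range (μ 0 + μ 1), S.ser i q * G.topE q k :=
    G.ser_eq_sum_topE
  have hdiag : ∀ i j, i < μ 0 + μ 1 → j < μ 0 + μ 1 → G.topE i j = if i = j then 1 else 0 :=
    fun i j _ hj => G.topE_diag i j hj
  set Y := S.twoVar (μ 0 + μ 1) (by omega) G.topE hE hdiag
  have hV := S.twoVar_V (μ 0 + μ 1) (by omega) G.topE hE hdiag
  have hEv : ∀ h k, Y.Ev (μ 0 + h) (μ 0 + μ 1 + k) = inV (G.serE 1 2 h k) :=
    fun h k => congrArg inV (G.topE_add h k)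
  have hcomm : ∀ i q h k, i < μ 0 → q < μ 0 → h < μ 1 → k < μ 2 →
      scomm (sgn ((p i + p q) * (p (μ 0 + h) + p (μ 0 + μ 1 + k)))) (Y.tu i q)
        (inV (G.serE 1 2 h k)) = 0 := by
    intro i q h k hi hq hh hk
    rw [← hEv]
    exact Y.scomm_tu_of_ne i q (μ 0 + h) (μ 0 + μ 1 + k) (by omega) (by omega) (by omega)
      (by omega) (by omega)
  have hpull : ∀ (F : ℕ → A⟦X⟧⟦X⟧) (b : ZMod 2) i h k, i < μ 0 → h < μ 1 → k < μ 2 →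
      scomm (sgn ((p i + b) * (p (μ 0 + h) + p (μ 0 + μ 1 + k))))
        (∑ q ∈ Finset.range (μ 0), Y.tu i q * F q) (inV (G.serE 1 2 h k)) =
      ∑ q ∈ Finset.range (μ 0), Y.tu i q *
        scomm (sgn ((p q + b) * (p (μ 0 + h) + p (μ 0 + μ 1 + k)))) (F q)
          (inV (G.serE 1 2 h k)) := by
    intro F b i h k hi hh hk
    rw [scomm_sum_left]
    refine Finset.sum_congr rfl fun q hq => ?_
    have h1 : sgn ((p i + b) * (p (μ 0 + h) + p (μ 0 + μ 1 + k))) =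
        sgn ((p i + p q) * (p (μ 0 + h) + p (μ 0 + μ 1 + k))) *
          sgn ((p q + b) * (p (μ 0 + h) + p (μ 0 + μ 1 + k))) := by
      rw [← sgn_add, ← add_mul]
      congr 2
      generalize p i = a, p q = c
      revert a b c
      decide
    rw [h1, scomm_mul_left, hcomm i q h k hi (Finset.mem_range.1 hq) hh hk, zero_mul, smul_zero,
      add_zero]
  refine PowerSeries.ext fun s => ?_
  rw [map_zero]
  refine eq_zero_of_sum_mul_eq_zero (fun i j => S.ser i j) (fun i => coeff s (scomm
      (sgn ((p i + p (μ 0 + j) + p (μ 0 + h) + p (μ 0 + μ 1 + k)) *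
        (p (μ 0 + f) + p (μ 0 + μ 1 + g))))
      (scomm (sgn ((p i + p (μ 0 + j)) * (p (μ 0 + h) + p (μ 0 + μ 1 + k))))
        (inU (G.serE 0 1 i j)) (inV (G.serE 1 2 h k)))
      (inV (G.serE 1 2 f g))))
    (fun i _ j _ => by rw [RTT.ser, coeff_mk, S.t_zero]) (fun i hi => ?_) i hi
  have hrow : Y.tu i (μ 0 + j) =
      ∑ q ∈ Finset.range (μ 0), Y.tu i q * inU (G.serE 0 1 q j) := by
    obtain ⟨H, hH, hrow⟩ := G.exists_row i (by omega)
    have h1 := hrow 1 j (by omega) hj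
    rw [off_one, hH hi] at h1
    simp only [Pi.zero_apply, zero_mul, Finset.sum_const_zero, add_zero] at h1
    have h2 := congrArg inU h1
    rw [map_sum] at h2
    simp only [map_mul] at h2
    exact h2
  have hmain := Y.scomm_scomm_tu hV i (μ 0 + j) (μ 0 + h) (μ 0 + μ 1 + k) (μ 0 + f)
    (μ 0 + μ 1 + g) (by omega) (by omega) (by omega) (by omega) (by omega) (by omega)
  rw [hEv, hEv, hrow, hpull _ _ i h k hi hh hk, add_assoc (p i + _), add_assoc (p i),
    hpull _ _ i f g hi hf hg] at hmain
  have hs := congrArg (coeff s) hmain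
  rw [map_sum, map_zero] at hs
  rw [← hs]
  refine Finset.sum_congr rfl fun q _ => ?_
  have htu : Y.tu i q = C (S.ser i q) := rfl
  rw [htu, coeff_C_mul, add_assoc (p q + _), add_assoc (p q)]

end ThreeBlocks

/-- For `μ = (μ 0, μ 1, μ 2)`, the Serre-type relation
`[[E_{1;i,j}(u), E_{2;h,k}(v)], E_{2;f,g}(v)] = 0` holds in `Y[[u^{-1}, v^{-1}]]`,
stated as the vanishing of the coefficient of `u^{-r} v^{-s}` for all `r, s ≥ 0`
(the inner and outer brackets are supercommutators, and the products in the same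
variable `v` are expanded by convolution). -/
theorem statement11 [Ring A] [Algebra ℂ A] {d : ℕ} {p : ℕ → ZMod 2} {μ : ℕ → ℕ}
    (S : RTT A d p) (G : Gauss S.t 3 μ) (hd : off μ 3 = d) :
    ∀ i j h k f g r s : ℕ,
      i < μ 0 → j < μ 1 → h < μ 1 → k < μ 2 → f < μ 1 → g < μ 2 →
      ∑ c ∈ Finset.range (s + 1),
        scomm
          (sgn ((p i + p (μ 0 + j) + p (μ 0 + h) + p (μ 0 + μ 1 + k)) *
            (p (μ 0 + f) + p (μ 0 + μ 1 + g))))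
          (scomm (sgn ((p i + p (μ 0 + j)) * (p (μ 0 + h) + p (μ 0 + μ 1 + k))))
            (G.E 0 1 i j r) (G.E 1 2 h k c))
          (G.E 1 2 f g (s - c)) = 0 := by
  intro i j h k f g r s hi hj hh hk hf hg
  have key := congrArg (fun z => PowerSeries.coeff r (PowerSeries.coeff s z))
    (scomm_scomm_serE S G hd i j h k f g hi hj hh hk hf hg)
  simp only [map_zero] at key
  rw [coeff_scomm_inV] at key
  simpa only [coeff_scomm_inU_inV, Gauss.serE, PowerSeries.coeff_mk] using key

end SuperYangian
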